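/- arXiv:2303.14305 — 5 statements merged into one kernel-verified Lean document; each statement's English description precedes it below -/
import Mathlib

section
/- The coefficients F₂(x) = I, F₁(x) = [[−2x+2b, −2abx+2a],[0, −2x]], F₀ = [[−2, 0],[0, 0]] of the differential operator D satisfy the second-order symmetry equations with respect to W: for all x ∈ ℝ, F₂(x)W(x) = W(x)F₂(x)ᵀ, 2(F₂W)′(x) − F₁(x)W(x) = W(x)F₁(x)ᵀ, and (F₂W)″(x) − (F₁W)′(x) + F₀W(x) = W(x)F₀ᵀ, where derivatives of matrix-valued functions are taken entrywise. Hence D is a W-symmetric operator. -/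
open Matrix

/-- The weight matrix `W(x) = e^{-x²} [[e^{2bx} + a²x², ax],[ax, 1]]`. -/
noncomputable def W (a b : ℝ) (x : ℝ) : Matrix (Fin 2) (Fin 2) ℝ :=
  Real.exp (-x^2) • !![Real.exp (2*b*x) + a^2*x^2, a*x; a*x, 1]

/-- Entrywise derivative of a matrix-valued function on `ℝ`. -/
noncomputable def mderiv (G : ℝ → Matrix (Fin 2) (Fin 2) ℝ) (x : ℝ) :
    Matrix (Fin 2) (Fin 2) ℝ :=
  Matrix.of fun i j => deriv (fun t => G t i j) x

/-- The leading coefficient `F₂ = I` of the operator `D`. -/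
noncomputable def F2 : ℝ → Matrix (Fin 2) (Fin 2) ℝ := fun _ => 1

/-- The coefficient `F₁(x) = [[-2x+2b, -2abx+2a],[0, -2x]]` of the operator `D`. -/
noncomputable def F1 (a b : ℝ) (x : ℝ) : Matrix (Fin 2) (Fin 2) ℝ :=
  !![-2*x + 2*b, -2*a*b*x + 2*a; 0, -2*x]

/-- The coefficient `F₀ = [[-2, 0],[0, 0]]` of the operator `D`. -/
noncomputable def F0 : Matrix (Fin 2) (Fin 2) ℝ :=
  !![-2, 0; 0, 0]

/-- An entrywise derivative is computed by exhibiting the derivative of each entry. -/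
lemma mderiv_eq_of_hasDerivAt {G : ℝ → Matrix (Fin 2) (Fin 2) ℝ} {x : ℝ}
    {M : Matrix (Fin 2) (Fin 2) ℝ} (h : ∀ i j, HasDerivAt (fun t => G t i j) (M i j) x) :
    mderiv G x = M := by
  ext i j
  exact (h i j).deriv

lemma hasDerivAt_exp_neg_sq (x : ℝ) :
    HasDerivAt (fun t : ℝ => Real.exp (-t ^ 2)) (Real.exp (-x ^ 2) * (-2 * x)) x := by
  simpa using ((hasDerivAt_id x).pow 2).neg.exp

lemma hasDerivAt_exp_const_mul (c x : ℝ) :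
    HasDerivAt (fun t : ℝ => Real.exp (c * t)) (Real.exp (c * x) * c) x := by
  simpa using ((hasDerivAt_id x).const_mul c).exp

/-- The derivative of `e^{-x²} (p(x) e^{cx} + q(x))`. -/
lemma hasDerivAt_exp_neg_sq_mul {p q : ℝ → ℝ} {p' q' x : ℝ} (c : ℝ)
    (hp : HasDerivAt p p' x) (hq : HasDerivAt q q' x) :
    HasDerivAt (fun t => Real.exp (-t ^ 2) * (p t * Real.exp (c * t) + q t))
      (Real.exp (-x ^ 2) * ((p' + (c - 2 * x) * p x) * Real.exp (c * x)
        + (q' - 2 * x * q x))) x := by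
  refine ((hasDerivAt_exp_neg_sq x).mul
    ((hp.mul (hasDerivAt_exp_const_mul c x)).add hq)).congr_deriv ?_
  simp only [Pi.add_apply, Pi.mul_apply]
  ring

/-- The derivative of `e^{-x²} ((p₀ + p₁x) e^{cx} + q₀ + q₁x + q₂x² + q₃x³)`. -/
lemma hasDerivAt_exp_neg_sq_mul_poly (c p₀ p₁ q₀ q₁ q₂ q₃ x : ℝ) :
    HasDerivAt (fun t => Real.exp (-t ^ 2) * ((p₀ + p₁ * t) * Real.exp (c * t)
        + (q₀ + q₁ * t + q₂ * t ^ 2 + q₃ * t ^ 3)))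
      (Real.exp (-x ^ 2) * ((p₁ + (c - 2 * x) * (p₀ + p₁ * x)) * Real.exp (c * x)
        + (q₁ + 2 * q₂ * x + 3 * q₃ * x ^ 2
          - 2 * x * (q₀ + q₁ * x + q₂ * x ^ 2 + q₃ * x ^ 3)))) x := by
  refine hasDerivAt_exp_neg_sq_mul c (p := fun t => p₀ + p₁ * t)
    (q := fun t => q₀ + q₁ * t + q₂ * t ^ 2 + q₃ * t ^ 3) ?_ ?_
  · simpa using ((hasDerivAt_id x).const_mul p₁).const_add p₀
  · refine (((((hasDerivAt_id x).const_mul q₁).const_add q₀).add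
      ((hasDerivAt_pow 2 x).const_mul q₂)).add
      ((hasDerivAt_pow 3 x).const_mul q₃)).congr_deriv ?_
    norm_num
    ring

/-- The entrywise derivative of `W`. -/
lemma mderiv_W (a b x : ℝ) :
    mderiv (W a b) x = Real.exp (-x ^ 2) •
      !![(2 * b - 2 * x) * Real.exp (2 * b * x) + 2 * a ^ 2 * x - 2 * a ^ 2 * x ^ 3,
        a - 2 * a * x ^ 2; a - 2 * a * x ^ 2, -2 * x] := by
  apply mderiv_eq_of_hasDerivAt
  intro i j
  fin_cases i <;> fin_cases j
  · convert hasDerivAt_exp_neg_sq_mul_poly (2 * b) 1 0 0 0 (a ^ 2) 0 x using 1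
    · ext t; simp [W]
    · simp; ring
  · convert hasDerivAt_exp_neg_sq_mul_poly (2 * b) 0 0 0 a 0 0 x using 1
    · ext t; simp [W]
    · simp; ring
  · convert hasDerivAt_exp_neg_sq_mul_poly (2 * b) 0 0 0 a 0 0 x using 1
    · ext t; simp [W]
    · simp; ring
  · convert hasDerivAt_exp_neg_sq_mul_poly (2 * b) 0 0 1 0 0 0 x using 1
    · ext t; simp [W]
    · simp

lemma F1_mul_W (a b x : ℝ) :
    F1 a b x * W a b x = Real.exp (-x ^ 2) •
      !![(2 * b - 2 * x) * Real.exp (2 * b * x) + 2 * a ^ 2 * x - 2 * a ^ 2 * x ^ 3,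
        2 * a - 2 * a * x ^ 2; -2 * a * x ^ 2, -2 * x] := by
  ext i j
  fin_cases i <;> fin_cases j <;> simp [F1, W, Matrix.mul_apply, Fin.sum_univ_two] <;> ring

lemma F1_mul_W_eq (a b x : ℝ) :
    F1 a b x * W a b x = mderiv (W a b) x + (a * Real.exp (-x ^ 2)) • (!![0, 1; -1, 0] : Matrix (Fin 2) (Fin 2) ℝ) := by
  rw [F1_mul_W, mderiv_W]
  ext i j
  fin_cases i <;> fin_cases j <;> simp <;> ring

/-- The entries of `W'` are differentiable, so that the derivative of `F₁W` splits. -/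
lemma differentiableAt_mderiv_W (a b x : ℝ) (i j : Fin 2) :
    DifferentiableAt ℝ (fun t => mderiv (W a b) t i j) x := by
  simp only [mderiv_W]
  fin_cases i <;> fin_cases j <;> simp <;> fun_prop

lemma mderiv_F1_mul_W (a b x : ℝ) :
    mderiv (fun t => F1 a b t * W a b t) x =
      mderiv (mderiv (W a b)) x + (-2 * a * x * Real.exp (-x ^ 2)) • (!![0, 1; -1, 0] : Matrix (Fin 2) (Fin 2) ℝ) := by
  apply mderiv_eq_of_hasDerivAt
  intro i j
  simp only [F1_mul_W_eq, Matrix.add_apply, Matrix.smul_apply, smul_eq_mul]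
  refine (differentiableAt_mderiv_W a b x i j).hasDerivAt.add ?_
  refine (((hasDerivAt_exp_neg_sq x).const_mul a).mul_const
    ((!![0, 1; -1, 0] : Matrix (Fin 2) (Fin 2) ℝ) i j)).congr_deriv ?_
  ring

lemma transpose_W (a b x : ℝ) : (W a b x)ᵀ = W a b x := by
  ext i j
  fin_cases i <;> fin_cases j <;> simp [W]

/-- The coefficients of the second-order operator
`D = ∂²F₂ + ∂F₁ + F₀` satisfy the symmetry equations with respect to `W`,
hence `D` is `W`-symmetric. -/
theorem stmt1 (a b : ℝ) (ha : a ≠ 0) (hb : b ≠ 0) (x : ℝ) :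
    F2 x * W a b x = W a b x * (F2 x)ᵀ ∧
    (2 : ℝ) • mderiv (fun t => F2 t * W a b t) x - F1 a b x * W a b x
      = W a b x * (F1 a b x)ᵀ ∧
    mderiv (mderiv (fun t => F2 t * W a b t)) x
      - mderiv (fun t => F1 a b t * W a b t) x + F0 * W a b x
      = W a b x * F0ᵀ := by
  have hF2 : (fun t => F2 t * W a b t) = W a b := by
    ext1 t
    simp [F2]
  refine ⟨by simp [F2], ?_, ?_⟩
  · have h : W a b x * (F1 a b x)ᵀ = (F1 a b x * W a b x)ᵀ := by
      rw [Matrix.transpose_mul, transpose_W]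
    rw [hF2, h, F1_mul_W, mderiv_W]
    ext i j
    fin_cases i <;> fin_cases j <;> simp <;> ring
  · rw [hF2, mderiv_F1_mul_W, sub_add_cancel_left]
    ext i j
    fin_cases i <;> fin_cases j <;>
      simp [F0, W, Matrix.mul_apply, Fin.sum_univ_two] <;> ring
end

section
/- Let n be an odd natural number and let F_j ∈ Mat₂(ℂ[x]) (0 ≤ j ≤ n) be upper triangular matrix polynomials whose entries have degree at most j, satisfying the commutation equations with D. Then F_n = 0. In other words, there is no differential operator of odd order with such coefficients (nonzero leading coefficient) commuting with D. -/
open Matrix Polynomial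

/-- Entrywise formal derivative of a matrix polynomial. -/
noncomputable def matD (F : Matrix (Fin 2) (Fin 2) (Polynomial ℂ)) :
    Matrix (Fin 2) (Fin 2) (Polynomial ℂ) :=
  Matrix.of fun i j => Polynomial.derivative (F i j)

/-- `A = [[-2, -2ab],[0, -2]]`. -/
noncomputable def Amat (a b : ℝ) : Matrix (Fin 2) (Fin 2) (Polynomial ℂ) :=
  !![C (-2 : ℂ), C (-2*(a:ℂ)*(b:ℂ)); 0, C (-2 : ℂ)]

/-- The matrix polynomial `Ax + B = [[-2x+2b, -2abx+2a],[0, -2x]]`. -/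
noncomputable def L (a b : ℝ) : Matrix (Fin 2) (Fin 2) (Polynomial ℂ) :=
  !![C (-2 : ℂ) * X + C (2*(b:ℂ)), C (-2*(a:ℂ)*(b:ℂ)) * X + C (2*(a:ℂ));
     0, C (-2 : ℂ) * X]

/-- `C = [[-2, 0],[0, 0]]`. -/
noncomputable def Cmat : Matrix (Fin 2) (Fin 2) (Polynomial ℂ) :=
  !![C (-2 : ℂ), 0; 0, 0]

/-- The commutation equations with `D = ∂²I + ∂(Ax+B) + C` for a family
`F₀, …, F_n` (extended by `0` outside `0..n`): for every `0 ≤ k ≤ n+1`,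
`2F_{k-1}' + F_{k-1}(Ax+B) - (Ax+B)F_{k-1} = kAF_k + CF_k - F_kC - F_k'' - F_k'(Ax+B)`. -/
def CommEqs (a b : ℝ) (n : ℕ) (F : ℤ → Matrix (Fin 2) (Fin 2) (Polynomial ℂ)) : Prop :=
  ∀ k : ℤ, 0 ≤ k → k ≤ (n : ℤ) + 1 →
    (2 : ℕ) • matD (F (k-1)) + F (k-1) * L a b - L a b * F (k-1)
      = (k : ℂ) • (Amat a b * F k) + Cmat * F k - F k * Cmat
        - matD (matD (F k)) - matD (F k) * L a b

/-- Let `u j` be the coefficient of `∂^(n-j)` in a scalar operator of order `n` commuting with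
`∂² + ∂(-2x + β)`. If `n` is odd, the leading coefficient `u 0` vanishes. -/
lemma scalar_leading_eq_zero (β : ℂ) {n : ℕ} (hn : Odd n) (u : ℕ → Polynomial ℂ)
    (h0 : derivative (u 0) = 0) (hlast : u (n + 1) = 0)
    (hrec : ∀ j ≤ n, 2 * derivative (u (j + 1)) =
      C (-2 * ((n : ℂ) - j)) * u j - derivative (derivative (u j))
        - derivative (u j) * (C (-2) * X + C β)) :
    u 0 = 0 := by
  have hcoeff : ∀ j ≤ n, ∀ i, 2 * ((u (j + 1)).coeff (i + 1) * (i + 1)) =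
      (2 * i - 2 * ((n : ℂ) - j)) * (u j).coeff i
        - (u j).coeff (i + 2) * (i + 2) * (i + 1) - β * ((u j).coeff (i + 1) * (i + 1)) := by
    intro j hj i
    have h := congrArg (fun p => coeff p i) (hrec j hj)
    have hX : (derivative (u j) * X).coeff i = (u j).coeff i * i := by
      cases i with
      | zero => simp
      | succ i => simp [coeff_derivative]
    have hsplit : derivative (u j) * (C (-2) * X + C β) =
        C (-2) * (derivative (u j) * X) + C β * derivative (u j) := by ring
    rw [hsplit, ← C_ofNat] at h
    simp only [coeff_sub, coeff_add, coeff_C_mul, hX, coeff_derivative] at h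
    push_cast at h
    linear_combination h
  have hhigh : ∀ j ≤ n + 1, ∀ i, j < i → (u j).coeff i = 0 := by
    intro j
    induction j with
    | zero =>
      intro _ i hi
      obtain ⟨i, rfl⟩ : ∃ m, i = m + 1 := ⟨i - 1, by omega⟩
      have h := congrArg (fun p => coeff p i) h0
      simp only [coeff_derivative, coeff_zero] at h
      exact (mul_eq_zero.mp h).resolve_right (Nat.cast_add_one_ne_zero i)
    | succ j ih =>
      intro hj i hi
      obtain ⟨i, rfl⟩ : ∃ m, i = m + 1 := ⟨i - 1, by omega⟩
      have ih := ih (by omega)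
      have h := hcoeff j (by omega) i
      rw [ih i (by omega), ih (i + 1) (by omega), ih (i + 2) (by omega)] at h
      have h' : (u (j + 1)).coeff (i + 1) * ((i : ℂ) + 1) = 0 := by linear_combination h / 2
      exact (mul_eq_zero.mp h').resolve_right (Nat.cast_add_one_ne_zero i)
  have hdiag : ∀ j ≤ n + 1, (u j).coeff j = 0 := by
    intro j hj
    induction hj using Nat.decreasingInduction with
    | self => simp [hlast]
    | of_succ j hj ih =>
      have h := hcoeff j (by omega) j
      rw [ih, hhigh j (by omega) (j + 1) (by omega), hhigh j (by omega) (j + 2) (by omega)] at h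
      have h' : (2 * (j : ℂ) - n) * (u j).coeff j = 0 := by linear_combination -h / 2
      refine (mul_eq_zero.mp h').resolve_left fun hzero => ?_
      have hnat : 2 * j = n := by exact_mod_cast sub_eq_zero.mp hzero
      exact (Nat.not_even_iff_odd.mpr hn) (hnat ▸ even_two_mul j)
  ext i
  cases i with
  | zero => exact hdiag 0 (by omega)
  | succ i => exact hhigh 0 (by omega) (i + 1) (by omega)

/-- A polynomial which is an eigenvector of the derivative for a nonzero eigenvalue vanishes. -/
lemma eq_zero_of_derivative_eq_C_mul {c : ℂ} (hc : c ≠ 0) {p : Polynomial ℂ}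
    (h : derivative p = C c * p) : p = 0 := by
  by_contra hp
  have hlt := degree_derivative_lt hp
  rw [h, degree_C_mul hc] at hlt
  exact lt_irrefl _ hlt

/-- There is no differential operator of odd order commuting with `D`: if `n` is
odd and upper triangular matrix polynomials `F_j` with entries of degree `≤ j`
satisfy the commutation equations with `D`, then the leading coefficient `F_n`
vanishes. -/
theorem stmt7 (a b : ℝ) (ha : a ≠ 0) (hb : b ≠ 0) (n : ℕ) (hn : Odd n)
    (F : ℤ → Matrix (Fin 2) (Fin 2) (Polynomial ℂ))
    (hvan : ∀ j : ℤ, (j < 0 ∨ (n : ℤ) < j) → F j = 0)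
    (htri : ∀ j : ℤ, (F j) 1 0 = 0)
    (hdeg : ∀ j : ℤ, ∀ i i' : Fin 2, ((F j) i i').degree ≤ (j.toNat : WithBot ℕ))
    (hcomm : CommEqs a b n F) :
    F (n : ℤ) = 0 := by
  have entry (k : ℤ) (h0 : 0 ≤ k) (h1 : k ≤ (n : ℤ) + 1) (i i' : Fin 2) :=
    congrFun (congrFun (hcomm k h0 h1) i) i'
  simp only [Matrix.sub_apply, Matrix.add_apply, Matrix.smul_apply, Matrix.mul_apply,
    Fin.sum_univ_two, matD, Matrix.of_apply, smul_eq_C_mul] at entry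
  simp only [nsmul_eq_mul, Nat.cast_ofNat] at entry
  have htop : F ((n : ℤ) + 1) = 0 := hvan _ (Or.inr (by omega))
  have hneg : F ((n : ℤ) - (n + 1 : ℕ)) = 0 := hvan _ (Or.inl (by push_cast; omega))
  have hidx (j : ℕ) : (n : ℤ) - (j + 1 : ℕ) = (n : ℤ) - j - 1 := by push_cast; ring
  have hp : F n 0 0 = 0 := by
    have hrec (k : ℤ) (h0 : 0 ≤ k) (h1 : k ≤ (n : ℤ) + 1) :
        2 * derivative (F (k - 1) 0 0) = C (-2 * (k : ℂ)) * F k 0 0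
          - derivative (derivative (F k 0 0))
          - derivative (F k 0 0) * (C (-2) * X + C (2 * (b : ℂ))) := by
      have h := entry k h0 h1 0 0
      simp [L, Amat, Cmat, htri] at h ⊢
      linear_combination h
    have hmain := scalar_leading_eq_zero (2 * (b : ℂ)) hn
      (fun j => F ((n : ℤ) - j) 0 0) ?_ (by simp only [hneg, Matrix.zero_apply]) ?_
    · simpa using hmain
    · simpa [htop] using hrec (n + 1) (by omega) le_rfl
    · intro j hj
      simpa only [hidx, Int.cast_sub, Int.cast_natCast] using hrec ((n : ℤ) - j) (by omega) (by omega)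
  have hq : F n 1 1 = 0 := by
    have hrec (k : ℤ) (h0 : 0 ≤ k) (h1 : k ≤ (n : ℤ) + 1) :
        2 * derivative (F (k - 1) 1 1) = C (-2 * (k : ℂ)) * F k 1 1
          - derivative (derivative (F k 1 1))
          - derivative (F k 1 1) * (C (-2) * X + C 0) := by
      have h := entry k h0 h1 1 1
      simp [L, Amat, Cmat, htri] at h ⊢
      linear_combination h
    have hmain := scalar_leading_eq_zero 0 hn
      (fun j => F ((n : ℤ) - j) 1 1) ?_ (by simp only [hneg, Matrix.zero_apply]) ?_
    · simpa using hmain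
    · simpa [htop] using hrec (n + 1) (by omega) le_rfl
    · intro j hj
      simpa only [hidx, Int.cast_sub, Int.cast_natCast] using hrec ((n : ℤ) - j) (by omega) (by omega)
  have hr : F n 0 1 = 0 := by
    refine eq_zero_of_derivative_eq_C_mul (c := (b : ℂ)) (by exact_mod_cast hb) ?_
    have h := entry (n + 1) (by omega) le_rfl 0 1
    simp [htop, L, hp, hq] at h
    have h2 : (2 : Polynomial ℂ) * (derivative (F n 0 1) - C (b : ℂ) * F n 0 1) = 0 := by
      rw [← C_ofNat] at h ⊢
      linear_combination h
    exact sub_eq_zero.mp ((mul_eq_zero.mp h2).resolve_left two_ne_zero)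
  ext1 i i'
  fin_cases i <;> fin_cases i' <;> simp [hp, hq, hr, htri]
end

section
/- Let T(x) = [[1, ax],[0, 1]] and let D̃ be the diagonal differential operator acting on matrix polynomials by Q·D̃ = Q″ + Q′G₁ + QG₀, with G₁(x) = diag(−2x + 2b, −2x) and G₀ = diag(−2, 0). Then D = T·D̃·T^{−1}: for every matrix polynomial P ∈ Mat₂(ℂ[x]), (P·D)·T = (P·T)·D̃, where ·T denotes right multiplication by the matrix polynomial T. -/
open Matrix Polynomial

/-- `F₁(x) = [[-2x+2b, -2abx+2a],[0, -2x]]`. -/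
noncomputable def F1op (a b : ℝ) : Matrix (Fin 2) (Fin 2) (Polynomial ℂ) :=
  !![C (-2 : ℂ) * X + C (2*(b:ℂ)), C (-2*(a:ℂ)*(b:ℂ)) * X + C (2*(a:ℂ));
     0, C (-2 : ℂ) * X]

/-- `F₀ = [[-2, 0],[0, 0]]`. -/
noncomputable def F0op : Matrix (Fin 2) (Fin 2) (Polynomial ℂ) :=
  !![C (-2 : ℂ), 0; 0, 0]

/-- Right action of the differential operator `D`: `Q·D = Q'' + Q'F₁ + QF₀`. -/
noncomputable def actD (a b : ℝ) (Q : Matrix (Fin 2) (Fin 2) (Polynomial ℂ)) :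
    Matrix (Fin 2) (Fin 2) (Polynomial ℂ) :=
  matD (matD Q) + matD Q * F1op a b + Q * F0op

/-- `G₁(x) = diag(-2x + 2b, -2x)`. -/
noncomputable def G1op (b : ℝ) : Matrix (Fin 2) (Fin 2) (Polynomial ℂ) :=
  !![C (-2 : ℂ) * X + C (2*(b:ℂ)), 0; 0, C (-2 : ℂ) * X]

/-- `G₀ = diag(-2, 0)`. -/
noncomputable def G0op : Matrix (Fin 2) (Fin 2) (Polynomial ℂ) :=
  !![C (-2 : ℂ), 0; 0, 0]

/-- Right action of the diagonal operator `D̃`: `Q·D̃ = Q'' + Q'G₁ + QG₀`. -/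
noncomputable def actDtil (b : ℝ) (Q : Matrix (Fin 2) (Fin 2) (Polynomial ℂ)) :
    Matrix (Fin 2) (Fin 2) (Polynomial ℂ) :=
  matD (matD Q) + matD Q * G1op b + Q * G0op

/-- `T(x) = [[1, ax],[0, 1]]` as a matrix polynomial. -/
noncomputable def Tm (a : ℝ) : Matrix (Fin 2) (Fin 2) (Polynomial ℂ) :=
  !![1, C (a:ℂ) * X; 0, 1]

/-- `D = T·D̃·T⁻¹`: for every matrix polynomial `P`, `(P·D)·T = (P·T)·D̃`. -/
theorem stmt15 (a b : ℝ) (ha : a ≠ 0) (hb : b ≠ 0)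
    (P : Matrix (Fin 2) (Fin 2) (Polynomial ℂ)) :
    actD a b P * Tm a = actDtil b (P * Tm a) := by
  have hC : (C 2 : ℂ[X]) = 2 := C_ofNat 2
  ext1 i j
  fin_cases j <;>
  · simp [actD, actDtil, matD, F1op, F0op, G1op, G0op, Tm, Matrix.mul_apply, Fin.sum_univ_two, hC]
    try ring
end

section
/- For all natural numbers n ≠ m, ∫_ℝ Q(x,n)·W(x)·Q(x,m)ᵀ dx = 0 (the 2×2 zero matrix; the integral is taken entrywise and all entries are integrable). Moreover, every entry of Q(x,n) − M_n·x^n is a polynomial of degree at most n − 1, where M_n = [[1, nab],[0, 2e^{b²} + a²n]]. In particular {Q(·,n)} is a sequence of orthogonal matrix polynomials for W with nonsingular leading coefficients M_n. -/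
open Matrix Polynomial MeasureTheory

/-- Monic Hermite polynomials: `H₀ = 1`, `H₁ = x`,
`H_{n+1}(x) = x H_n(x) - (n/2) H_{n-1}(x)`. -/
noncomputable def H : ℕ → Polynomial ℝ
  | 0 => 1
  | 1 => X
  | (n+2) => X * H (n+1) - C (((n:ℝ)+1)/2) * H n

/-- The orthogonal matrix polynomials
`Q(x,n) = [[H_n(x-b), aH_{n+1}(x) - axH_n(x-b)],
           [-anH_{n-1}(x-b), 2e^{b²}H_n(x) + a²nxH_{n-1}(x-b)]]`. -/
noncomputable def Qm (a b : ℝ) (n : ℕ) : Matrix (Fin 2) (Fin 2) (Polynomial ℝ) :=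
  !![(H n).comp (X - C b),
     C a * H (n+1) - C a * X * (H n).comp (X - C b);
     -(C (a * (n:ℝ)) * (H (n-1)).comp (X - C b)),
     C (2 * Real.exp (b^2)) * H n + C (a^2 * (n:ℝ)) * X * (H (n-1)).comp (X - C b)]

/-- The leading coefficient `M_n = [[1, nab],[0, 2e^{b²} + a²n]]`. -/
noncomputable def Mlead (a b : ℝ) (n : ℕ) : Matrix (Fin 2) (Fin 2) ℝ :=
  !![1, (n:ℝ)*a*b; 0, 2*Real.exp (b^2) + a^2*(n:ℝ)]

theorem Polynomial.integrable_eval_mul_exp_neg_sq (p : ℝ[X]) :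
    Integrable fun x : ℝ => p.eval x * Real.exp (-x ^ 2) := by
  induction p using Polynomial.induction_on' with
  | add p q hp hq =>
    simp only [eval_add, add_mul]
    exact hp.add hq
  | monomial n c =>
    have h := (integrable_rpow_mul_exp_neg_mul_sq one_pos
      (s := n) (by linarith [n.cast_nonneg (α := ℝ)])).const_mul c
    simpa [Real.rpow_natCast, mul_assoc] using h

/-- Integration of polynomials against the Gaussian weight `e^{-x²}`. -/
noncomputable def gaussianMoment : ℝ[X] →ₗ[ℝ] ℝ where
  toFun p := ∫ x : ℝ, p.eval x * Real.exp (-x ^ 2)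
  map_add' p q := by
    simp only [eval_add, add_mul]
    exact integral_add p.integrable_eval_mul_exp_neg_sq q.integrable_eval_mul_exp_neg_sq
  map_smul' c p := by
    simp only [eval_smul, smul_eq_mul, mul_assoc, RingHom.id_apply]
    exact integral_const_mul _ _

theorem gaussianMoment_C_mul (c : ℝ) (p : ℝ[X]) :
    gaussianMoment (C c * p) = c * gaussianMoment p := by
  rw [C_mul', map_smul, smul_eq_mul]

theorem gaussianMoment_derivative (p : ℝ[X]) :
    gaussianMoment (derivative p) = 2 * gaussianMoment (X * p) := by
  have h : gaussianMoment (derivative p - C 2 * (X * p)) = 0 := by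
    refine integral_eq_zero_of_hasDerivAt_of_integrable
      (f := fun x => p.eval x * Real.exp (-x ^ 2)) (fun x => ?_)
      (integrable_eval_mul_exp_neg_sq _) p.integrable_eval_mul_exp_neg_sq
    refine ((p.hasDerivAt x).mul (hasDerivAt_pow 2 x).neg.exp).congr_deriv ?_
    simp
    ring
  rw [map_sub, gaussianMoment_C_mul] at h
  linarith

theorem derivative_H_succ (n : ℕ) : derivative (H (n + 1)) = C ((n : ℝ) + 1) * H n := by
  induction n using Nat.twoStepInduction with
  | zero => simp [H]
  | one => simp [H]; norm_num [← C_1, ← C_ofNat]; ring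
  | more n h₁ h₂ =>
    rw [H, derivative_sub, derivative_mul, derivative_C_mul, h₁, h₂, H]
    simp only [derivative_X, Nat.cast_add, Nat.cast_one, div_eq_mul_inv, map_add, map_one,
      map_mul, map_natCast]
    ring

theorem H_succ (n : ℕ) : H (n + 1) = X * H n - C (1 / 2) * derivative (H n) := by
  cases n with
  | zero => simp [H]
  | succ n =>
    rw [derivative_H_succ, H, ← mul_assoc, ← C_mul]
    ring_nf

theorem gaussianMoment_H_succ_mul (n : ℕ) (p : ℝ[X]) :
    gaussianMoment (H (n + 1) * p) = 1 / 2 * gaussianMoment (H n * derivative p) := by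
  have h := gaussianMoment_derivative (H n * p)
  rw [derivative_mul, map_add] at h
  rw [H_succ, sub_mul, map_sub, mul_assoc, mul_assoc, gaussianMoment_C_mul]
  linarith

theorem gaussianMoment_H_succ_mul_H_succ (n m : ℕ) :
    gaussianMoment (H (n + 1) * H (m + 1)) = (m + 1) / 2 * gaussianMoment (H n * H m) := by
  rw [gaussianMoment_H_succ_mul, derivative_H_succ, mul_left_comm, gaussianMoment_C_mul]
  ring

theorem gaussianMoment_H_mul_H_of_ne {n m : ℕ} (h : n ≠ m) :
    gaussianMoment (H n * H m) = 0 := by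
  induction n generalizing m with
  | zero =>
    obtain ⟨m, rfl⟩ := Nat.exists_eq_succ_of_ne_zero h.symm
    rw [mul_comm, gaussianMoment_H_succ_mul]
    simp [H]
  | succ n ih =>
    cases m with
    | zero => rw [gaussianMoment_H_succ_mul]; simp [H]
    | succ m => rw [gaussianMoment_H_succ_mul_H_succ, ih (by omega), mul_zero]

/-- The first column, in the variable `x - b`, of `Q(x,n)·[[1, ax], [0, 1]]`. -/
noncomputable def Qleft (a : ℝ) (n : ℕ) : Fin 2 → ℝ[X] :=
  ![H n, -(C (a * n) * H (n - 1))]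

/-- The second column of `Q(x,n)·[[1, ax], [0, 1]]`. -/
noncomputable def Qright (a b : ℝ) (n : ℕ) : Fin 2 → ℝ[X] :=
  ![C a * H (n + 1), C (2 * Real.exp (b ^ 2)) * H n]

theorem Qm_mul_W_mul_transpose_apply (a b : ℝ) (n m : ℕ) (i j : Fin 2) (x : ℝ) :
    ((Qm a b n).map (eval x) * W a b x * ((Qm a b m).map (eval x))ᵀ) i j =
      Real.exp (b ^ 2) *
          ((Qleft a n i * Qleft a m j).eval (x - b) * Real.exp (-(x - b) ^ 2)) +
        (Qright a b n i * Qright a b m j).eval x * Real.exp (-x ^ 2) := by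
  have h : Real.exp (-(x - b) ^ 2) =
      Real.exp (-x ^ 2) * Real.exp (2 * b * x) * (Real.exp (b ^ 2))⁻¹ := by
    rw [← Real.exp_neg, ← Real.exp_add, ← Real.exp_add]
    ring_nf
  rw [h]
  have hb := Real.exp_ne_zero (b ^ 2)
  fin_cases i <;> fin_cases j <;>
    simp [Qm, W, Qleft, Qright, Matrix.mul_apply, Fin.sum_univ_two] <;> field_simp <;> ring

theorem integrable_Qm_mul_W_mul_transpose (a b : ℝ) (n m : ℕ) (i j : Fin 2) :
    Integrable fun x : ℝ =>
      ((Qm a b n).map (eval x) * W a b x * ((Qm a b m).map (eval x))ᵀ) i j := by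
  simp only [Qm_mul_W_mul_transpose_apply]
  exact (((integrable_eval_mul_exp_neg_sq _).comp_sub_right b).const_mul _).add
    (integrable_eval_mul_exp_neg_sq _)

theorem integral_Qm_mul_W_mul_transpose (a b : ℝ) (n m : ℕ) (i j : Fin 2) :
    ∫ x : ℝ, ((Qm a b n).map (eval x) * W a b x * ((Qm a b m).map (eval x))ᵀ) i j =
      Real.exp (b ^ 2) * gaussianMoment (Qleft a n i * Qleft a m j) +
        gaussianMoment (Qright a b n i * Qright a b m j) := by
  simp only [Qm_mul_W_mul_transpose_apply]
  rw [integral_add (((integrable_eval_mul_exp_neg_sq _).comp_sub_right b).const_mul _)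
    (integrable_eval_mul_exp_neg_sq _), integral_const_mul,
    integral_sub_right_eq_self (fun x => eval x (Qleft a n i * Qleft a m j) * Real.exp (-x ^ 2))]
  rfl

theorem gaussianMoment_C_mul_mul_C_mul (c d : ℝ) (p q : ℝ[X]) :
    gaussianMoment (C c * p * (C d * q)) = c * d * gaussianMoment (p * q) := by
  rw [mul_mul_mul_comm, ← C_mul, gaussianMoment_C_mul]

theorem natCast_mul_gaussianMoment_H_mul_H_pred (n m : ℕ) :
    m * gaussianMoment (H n * H (m - 1)) = 2 * gaussianMoment (H (n + 1) * H m) := by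
  cases m with
  | zero => simp [gaussianMoment_H_mul_H_of_ne n.succ_ne_zero]
  | succ m =>
    rw [gaussianMoment_H_succ_mul_H_succ, Nat.add_sub_cancel]
    push_cast
    ring

theorem gaussianMoment_Qleft_add_Qright (a b : ℝ) {n m : ℕ} (h : n ≠ m) (i j : Fin 2) :
    Real.exp (b ^ 2) * gaussianMoment (Qleft a n i * Qleft a m j) +
      gaussianMoment (Qright a b n i * Qright a b m j) = 0 := by
  have h_succ : n + 1 ≠ m + 1 := by omega
  have hnm := natCast_mul_gaussianMoment_H_mul_H_pred n m
  have hmn := natCast_mul_gaussianMoment_H_mul_H_pred m n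
  rw [mul_comm (H m), mul_comm (H (m + 1))] at hmn
  have h_pred : (n : ℝ) * m * gaussianMoment (H (n - 1) * H (m - 1)) = 0 := by
    rcases n with _ | n
    · simp
    rcases m with _ | m
    · simp
    simp [gaussianMoment_H_mul_H_of_ne (show n ≠ m by omega)]
  fin_cases i <;> fin_cases j <;>
    simp only [Qleft, Qright, Fin.zero_eta, Fin.mk_one, cons_val_zero, cons_val_one,
      mul_neg, neg_mul, neg_neg, map_neg, gaussianMoment_C_mul_mul_C_mul, mul_left_comm (H n),
      mul_assoc (C _) (H (n - 1)) (H m), gaussianMoment_C_mul,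
      gaussianMoment_H_mul_H_of_ne h, gaussianMoment_H_mul_H_of_ne h_succ, mul_zero, add_zero]
  · linear_combination -a * Real.exp (b ^ 2) * hnm
  · linear_combination -a * Real.exp (b ^ 2) * hmn
  · linear_combination a ^ 2 * Real.exp (b ^ 2) * h_pred

theorem X_mul_mem_degreeLT {p : ℝ[X]} {n : ℕ} (hp : p ∈ degreeLT ℝ n) :
    X * p ∈ degreeLT ℝ (n + 1) := by
  rw [mem_degreeLT, degree_lt_iff_coeff_zero] at *
  intro k hk
  obtain ⟨k, rfl⟩ := Nat.exists_eq_add_of_le' (Nat.one_le_of_lt hk)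
  rw [coeff_X_mul]
  exact hp k (by omega)

theorem C_mul_mem_degreeLT (c : ℝ) {p : ℝ[X]} {n : ℕ} (hp : p ∈ degreeLT ℝ n) :
    C c * p ∈ degreeLT ℝ n := by
  rw [C_mul']
  exact Submodule.smul_mem _ c hp

theorem X_pow_mem_degreeLT {k n : ℕ} (h : k < n) : (X ^ k : ℝ[X]) ∈ degreeLT ℝ n := by
  rw [mem_degreeLT, degree_X_pow]
  exact_mod_cast h

theorem H_comp_leading_terms (b : ℝ) (n : ℕ) :
    (H n).comp (X - C b) ∈ degreeLT ℝ (n + 1) ∧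
      (H (n + 1)).comp (X - C b) - X ^ (n + 1) + C ((n + 1) * b) * X ^ n ∈ degreeLT ℝ n := by
  induction n with
  | zero =>
    refine ⟨?_, by simp [H]⟩
    simpa [H] using X_pow_mem_degreeLT (k := 0) one_pos
  | succ n ih =>
    obtain ⟨h₁, h₂⟩ := ih
    have h_X := C_mul_mem_degreeLT ((n + 1) * b) (X_pow_mem_degreeLT n.lt_succ_self)
    have h₃ : (H (n + 1)).comp (X - C b) - X ^ (n + 1) ∈ degreeLT ℝ (n + 1) := by
      convert sub_mem (degreeLT_mono n.le_succ h₂) h_X using 1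
      ring
    constructor
    · convert add_mem (degreeLT_mono (n + 1).le_succ h₃)
        (X_pow_mem_degreeLT (n + 1).lt_succ_self) using 1
      ring
    · convert sub_mem (sub_mem (X_mul_mem_degreeLT h₂) (C_mul_mem_degreeLT b h₃))
        (C_mul_mem_degreeLT (((n : ℝ) + 1) / 2) h₁) using 1
      rw [H]
      simp only [sub_comp, mul_comp, X_comp, C_comp, Nat.cast_add, Nat.cast_one, map_add, map_mul,
        map_one]
      ring

theorem H_comp_sub_X_pow_mem_degreeLT (b : ℝ) (n : ℕ) :
    (H n).comp (X - C b) - X ^ n ∈ degreeLT ℝ n := by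
  cases n with
  | zero => simp [H]
  | succ n =>
    convert sub_mem (degreeLT_mono n.le_succ (H_comp_leading_terms b n).2)
      (C_mul_mem_degreeLT ((n + 1) * b) (X_pow_mem_degreeLT n.lt_succ_self)) using 1
    ring

theorem Qm_sub_Mlead_mul_X_pow_mem_degreeLT (a b : ℝ) (n : ℕ) (i j : Fin 2) :
    Qm a b n i j - C (Mlead a b n i j) * X ^ n ∈ degreeLT ℝ n := by
  cases n with
  | zero => fin_cases i <;> fin_cases j <;> simp [Qm, Mlead, H]
  | succ n =>
    have h_H := H_comp_sub_X_pow_mem_degreeLT 0 (n + 1)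
    have h_H' := (H_comp_leading_terms 0 (n + 1)).2
    simp only [map_zero, sub_zero, comp_X, mul_zero, zero_mul, add_zero] at h_H h_H'
    obtain ⟨h₁, h₂⟩ := H_comp_leading_terms b n
    fin_cases i <;> fin_cases j
    · simpa [Qm, Mlead] using H_comp_sub_X_pow_mem_degreeLT b (n + 1)
    · convert sub_mem (C_mul_mem_degreeLT a h_H')
        (C_mul_mem_degreeLT a (X_mul_mem_degreeLT h₂)) using 1
      simp [Qm, Mlead]
      ring
    · simpa [Qm, Mlead] using C_mul_mem_degreeLT (a * (n + 1)) h₁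
    · convert add_mem (C_mul_mem_degreeLT (2 * Real.exp (b ^ 2)) h_H)
        (C_mul_mem_degreeLT (a ^ 2 * (n + 1))
          (X_mul_mem_degreeLT (H_comp_sub_X_pow_mem_degreeLT b n))) using 1
      simp [Qm, Mlead]
      ring

theorem Mlead_det_ne_zero (a b : ℝ) (n : ℕ) : (Mlead a b n).det ≠ 0 := by
  rw [Mlead, det_fin_two_of, one_mul, mul_zero, sub_zero]
  positivity

/-- The `Q(·,n)` form a sequence of orthogonal matrix polynomials for `W`:
the entries of `Q(x,n) W(x) Q(x,m)ᵀ` are integrable and its integral vanishes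
for `n ≠ m`; moreover `Q(x,n) - M_n xⁿ` has entries of degree `< n`, and the
leading coefficients `M_n` are nonsingular. -/
theorem stmt17 (a b : ℝ) (ha : a ≠ 0) (hb : b ≠ 0) :
    (∀ n m : ℕ, ∀ i j : Fin 2,
      Integrable (fun x : ℝ =>
        ((Qm a b n).map (Polynomial.eval x) * W a b x
          * ((Qm a b m).map (Polynomial.eval x))ᵀ) i j)) ∧
    (∀ n m : ℕ, n ≠ m → ∀ i j : Fin 2,
      ∫ x : ℝ, ((Qm a b n).map (Polynomial.eval x) * W a b x
          * ((Qm a b m).map (Polynomial.eval x))ᵀ) i j = 0) ∧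
    (∀ n : ℕ, ∀ i j : Fin 2,
      ((Qm a b n) i j - C (Mlead a b n i j) * X^n).degree < (n : WithBot ℕ)) ∧
    (∀ n : ℕ, (Mlead a b n).det ≠ 0) := by
  refine ⟨integrable_Qm_mul_W_mul_transpose a b, fun n m h i j => ?_, fun n i j => ?_,
    Mlead_det_ne_zero a b⟩
  · rw [integral_Qm_mul_W_mul_transpose, gaussianMoment_Qleft_add_Qright a b h]
  · exact mem_degreeLT.mp (Qm_sub_Mlead_mul_X_pow_mem_degreeLT a b n i j)
end

section
/- For every n ≥ 1 the identity x·Q(x,n) = Ã_n·Q(x,n+1) + B̃_n·Q(x,n) + C̃_n·Q(x,n−1) holds in Mat₂(ℝ[x]), where Ã_n = [[1, −ab/(2e^{b²}+(n+1)a²)],[0, (2e^{b²}+na²)/(2e^{b²}+(n+1)a²)]], B̃_n = [[2e^{b²}b/(2e^{b²}+(n+1)a²), a/(2(2e^{b²}+na²))],[2e^{b²}a/(2e^{b²}+(n+1)a²), na²b/(2e^{b²}+na²)]], and C̃_n = [[(n/2)·((n+1)a²+2e^{b²})/(2e^{b²}+na²), 0],[−2nabe^{b²}/(2e^{b²}+na²),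 n/2]]. -/
open Matrix Polynomial

/-- `Ã_n`. -/
noncomputable def Atil (a b : ℝ) (n : ℕ) : Matrix (Fin 2) (Fin 2) ℝ :=
  !![1, -(a*b) / (2*Real.exp (b^2) + ((n:ℝ)+1)*a^2);
     0, (2*Real.exp (b^2) + (n:ℝ)*a^2) / (2*Real.exp (b^2) + ((n:ℝ)+1)*a^2)]

/-- `B̃_n`. -/
noncomputable def Btil (a b : ℝ) (n : ℕ) : Matrix (Fin 2) (Fin 2) ℝ :=
  !![2*Real.exp (b^2)*b / (2*Real.exp (b^2) + ((n:ℝ)+1)*a^2),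
       a / (2*(2*Real.exp (b^2) + (n:ℝ)*a^2));
     2*Real.exp (b^2)*a / (2*Real.exp (b^2) + ((n:ℝ)+1)*a^2),
       (n:ℝ)*a^2*b / (2*Real.exp (b^2) + (n:ℝ)*a^2)]

/-- `C̃_n`. -/
noncomputable def Ctil (a b : ℝ) (n : ℕ) : Matrix (Fin 2) (Fin 2) ℝ :=
  !![((n:ℝ)/2) * (((n:ℝ)+1)*a^2 + 2*Real.exp (b^2)) / (2*Real.exp (b^2) + (n:ℝ)*a^2), 0;
     -(2*(n:ℝ)*a*b*Real.exp (b^2)) / (2*Real.exp (b^2) + (n:ℝ)*a^2), (n:ℝ)/2]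

theorem eval_H_add_two (n : ℕ) (x : ℝ) :
    (H (n + 2)).eval x = x * (H (n + 1)).eval x - ((n : ℝ) + 1) / 2 * (H n).eval x := by
  simp only [H, eval_sub, eval_mul, eval_X, eval_C]

/-- The recursion with the predecessor in truncated subtraction; at `n = 0` its coefficient is `0`. -/
theorem natCast_mul_eval_H_sub_one (n : ℕ) (x : ℝ) :
    (n : ℝ) * (H (n - 1)).eval x = 2 * (x * (H n).eval x - (H (n + 1)).eval x) := by
  cases n with
  | zero => simp [H]
  | succ k =>
    rw [eval_H_add_two, Nat.add_sub_cancel]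
    push_cast
    ring

/-- The three-term recursion relation
`x Q(x,n) = Ã_n Q(x,n+1) + B̃_n Q(x,n) + C̃_n Q(x,n-1)` for `n ≥ 1`. -/
theorem stmt18 (a b : ℝ) (ha : a ≠ 0) (hb : b ≠ 0) (n : ℕ) (hn : 1 ≤ n) :
    (X : Polynomial ℝ) • Qm a b n
      = (Atil a b n).map C * Qm a b (n+1)
        + (Btil a b n).map C * Qm a b n
        + (Ctil a b n).map C * Qm a b (n-1) := by
  obtain ⟨m, rfl⟩ : ∃ m, n = m + 1 := ⟨n - 1, by omega⟩
  ext1 i j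
  apply Polynomial.funext
  intro x
  have h₁ : (H (m + 1 + 1)).eval (x - b) = _ := eval_H_add_two m (x - b)
  have h₂ := natCast_mul_eval_H_sub_one m (x - b)
  have h₃ : (H (m + 1 + 1 + 1)).eval x = _ := eval_H_add_two (m + 1) x
  have h₄ : (H (m + 1 + 1)).eval x = _ := eval_H_add_two m x
  push_cast at h₃
  fin_cases i <;> fin_cases j <;>
    simp [Qm, Atil, Btil, Ctil, Matrix.mul_apply, Fin.sum_univ_two]
  · linear_combination (norm := (field_simp; ring)) -h₁
  · linear_combination (norm := (field_simp; ring)) -a * h₃ + a * x * h₁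
  · linear_combination (norm := (field_simp; ring)) ((m : ℝ) + 1) * a / 2 * h₂
  · linear_combination (norm := (field_simp; ring))
      -((m : ℝ) + 1) * a ^ 2 * x / 2 * h₂ - 2 * Real.exp (b ^ 2) * h₄
end
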